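/- arXiv:math/0604150 — 6 statements merged into one kernel-verified Lean document; each statement's English description precedes it below -/
import Mathlib

section
/- Let C be an abelian category, (T, F) a torsion pair in C, and A(T, F) the tilted heart in D(C). For every object X of A(T, F), the objects H^{-1}(X)[1] and H^0(X) (complexes concentrated in one degree) belong to A(T, F), and there is a short exact sequence 0 → H^{-1}(X)[1] → X → H^0(X) → 0 in the abelian category A(T, F). -/
open CategoryTheory Category Limits Pretriangulated

universe w v u

/-- A torsion pair `(T, F)` in an abelian category `C`: a pair of full subcategories
(given by predicates on objects, closed under isomorphism) such that every morphism
from an object of `T` to an object of `F` is zero, and every object `E` fits into a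
short exact sequence `0 → T₀ → E → F₀ → 0` with `T₀ ∈ T` and `F₀ ∈ F`. -/
structure TorsionPair (C : Type u) [Category.{v} C] [Abelian C] where
  T : C → Prop
  F : C → Prop
  T_iso : ∀ {X Y : C}, (X ≅ Y) → T X → T Y
  F_iso : ∀ {X Y : C}, (X ≅ Y) → F X → F Y
  hom_zero : ∀ {X Y : C}, T X → F Y → ∀ f : X ⟶ Y, f = 0
  exists_ses : ∀ E : C, ∃ (A B : C) (f : A ⟶ E) (g : E ⟶ B) (w : f ≫ g = 0),
    (CategoryTheory.ShortComplex.mk f g w).ShortExact ∧ T A ∧ F B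

variable (C : Type u) [Category.{v} C] [Abelian C] [HasDerivedCategory.{w} C]

/-- Membership in the tilted heart `A(T, F) ⊆ D(C)` associated to a torsion pair:
cohomology vanishes outside degrees `-1` and `0`, `H^{-1}` lies in `F` and `H^0`
lies in `T`. -/
def memHeart (P : TorsionPair C) (X : DerivedCategory C) : Prop :=
  (∀ i : ℤ, i ≠ -1 → i ≠ 0 → IsZero ((DerivedCategory.homologyFunctor C i).obj X)) ∧
  P.F ((DerivedCategory.homologyFunctor C (-1)).obj X) ∧
  P.T ((DerivedCategory.homologyFunctor C 0).obj X)

namespace TorsionPair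

variable {A : Type u} [Category.{v} A] [Abelian A]

lemma T_of_isZero (P : TorsionPair A) {Z : A} (hZ : IsZero Z) : P.T Z := by
  obtain ⟨X, Y, f, g, w, hS, hX, hY⟩ := P.exists_ses Z
  have : Mono f := hS.mono_f
  exact P.T_iso ((hZ.of_mono f).iso hZ) hX

lemma F_of_isZero (P : TorsionPair A) {Z : A} (hZ : IsZero Z) : P.F Z := by
  obtain ⟨X, Y, f, g, w, hS, hX, hY⟩ := P.exists_ses Z
  have : Epi g := hS.epi_g
  exact P.F_iso ((hZ.of_epi g).iso hZ) hY

end TorsionPair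

namespace DerivedCategory

variable {C}

/-- The homology in degree `n` of the complex with `Y` placed in degree `n` is `Y`. -/
noncomputable def homologySingleIso (n : ℤ) (Y : C) :
    (homologyFunctor C n).obj ((singleFunctor C n).obj Y) ≅ Y :=
  (singleFunctorCompHomologyFunctorIso C n).app Y

lemma isZero_homology_single (n i : ℤ) (h : i ≠ n) (Y : C) :
    IsZero ((homologyFunctor C i).obj ((singleFunctor C n).obj Y)) := by
  rcases lt_or_gt_of_ne h with h | h
  · exact isZero_of_isGE _ n i h
  · exact isZero_of_isLE _ n i h

/-- An object concentrated in degree `n` is its homology placed in degree `n`. -/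
lemma nonempty_iso_single_homology (X : DerivedCategory C) (n : ℤ) [X.IsGE n] [X.IsLE n] :
    Nonempty (X ≅ (singleFunctor C n).obj ((homologyFunctor C n).obj X)) := by
  obtain ⟨Y, ⟨e⟩⟩ := X.exists_iso_singleFunctor_obj_of_isGE_of_isLE n
  exact ⟨e ≪≫ (singleFunctor C n).mapIso
    ((homologyFunctor C n).mapIso e ≪≫ homologySingleIso n Y).symm⟩

/-- The complex with `Y` in degree `0`, shifted by one, is `Y` placed in degree `-1`. -/
noncomputable def singleShiftOneIso (Y : C) :
    ((singleFunctor C 0).obj Y)⟦(1 : ℤ)⟧ ≅ (singleFunctor C (-1)).obj Y :=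
  ((singleFunctors C).shiftIso 1 (-1) 0 (by simp)).app Y

section

variable (T : Triangle (DerivedCategory C)) (hT : T ∈ distTriang _) (n : ℤ)

include hT

lemma isIso_homologyMap_mor₁ (h₀ : IsZero ((homologyFunctor C (n - 1)).obj T.obj₃))
    (h₁ : IsZero ((homologyFunctor C n).obj T.obj₃)) :
    IsIso ((homologyFunctor C n).map T.mor₁) := by
  have : Mono ((homologyFunctor C n).map T.mor₁) :=
    (HomologySequence.mono_homologyMap_mor₁_iff T hT (n - 1) n).2 (h₀.eq_of_src _ _)
  have : Epi ((homologyFunctor C n).map T.mor₁) :=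
    (HomologySequence.epi_homologyMap_mor₁_iff T hT n).2 (h₁.eq_of_tgt _ _)
  exact isIso_of_mono_of_epi _

lemma isIso_homologyMap_mor₂ (h₀ : IsZero ((homologyFunctor C n).obj T.obj₁))
    (h₁ : IsZero ((homologyFunctor C (n + 1)).obj T.obj₁)) :
    IsIso ((homologyFunctor C n).map T.mor₂) := by
  have : Mono ((homologyFunctor C n).map T.mor₂) :=
    (HomologySequence.mono_homologyMap_mor₂_iff T hT n).2 (h₀.eq_of_src _ _)
  have : Epi ((homologyFunctor C n).map T.mor₂) :=
    (HomologySequence.epi_homologyMap_mor₂_iff T hT n (n + 1)).2 (h₁.eq_of_tgt _ _)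
  exact isIso_of_mono_of_epi _

end

/-- An object with homology only in degrees `-1` and `0` is an extension of its homology
objects placed in these degrees. -/
lemma exists_distTriang_homology (X : DerivedCategory C) [X.IsGE (-1)] [X.IsLE 0] :
    ∃ (f : ((singleFunctor C 0).obj ((homologyFunctor C (-1)).obj X))⟦(1 : ℤ)⟧ ⟶ X)
      (g : X ⟶ (singleFunctor C 0).obj ((homologyFunctor C 0).obj X))
      (h : (singleFunctor C 0).obj ((homologyFunctor C 0).obj X) ⟶
        (((singleFunctor C 0).obj ((homologyFunctor C (-1)).obj X))⟦(1 : ℤ)⟧)⟦(1 : ℤ)⟧),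
      Triangle.mk f g h ∈ distTriang (DerivedCategory C) := by
  obtain ⟨A, B, hA, hB, f, g, h, hT⟩ := TStructure.t.exists_triangle X (-1) 0 (by simp)
  have hA_le : A.IsLE (-1) := ⟨hA⟩
  have hB_ge : B.IsGE 0 := ⟨hB⟩
  have iso₁ (n : ℤ) (hn : n < 0) : IsIso ((homologyFunctor C n).map f) :=
    isIso_homologyMap_mor₁ _ hT n (B.isZero_of_isGE 0 _ (by lia)) (B.isZero_of_isGE 0 _ hn)
  have iso₂ (n : ℤ) (hn : -1 < n) : IsIso ((homologyFunctor C n).map g) :=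
    isIso_homologyMap_mor₂ _ hT n (A.isZero_of_isLE (-1) _ hn)
      (A.isZero_of_isLE (-1) _ (by lia))
  have hA_ge : A.IsGE (-1) := by
    rw [isGE_iff]
    intro i hi
    have := iso₁ i (by lia)
    exact (X.isZero_of_isGE (-1) i hi).of_iso (asIso ((homologyFunctor C i).map f))
  have hB_le : B.IsLE 0 := by
    rw [isLE_iff]
    intro i hi
    have := iso₂ i (by lia)
    exact (X.isZero_of_isLE 0 i hi).of_iso (asIso ((homologyFunctor C i).map g)).symm
  have := iso₁ (-1) (by simp)
  have := iso₂ 0 (by simp)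
  obtain ⟨eA⟩ := A.nonempty_iso_single_homology (-1)
  obtain ⟨eB⟩ := B.nonempty_iso_single_homology 0
  let e₁ : ((singleFunctor C 0).obj ((homologyFunctor C (-1)).obj X))⟦(1 : ℤ)⟧ ≅ A :=
    singleShiftOneIso _ ≪≫
      ((singleFunctor C (-1)).mapIso (asIso ((homologyFunctor C (-1)).map f))).symm ≪≫ eA.symm
  let e₃ : (singleFunctor C 0).obj ((homologyFunctor C 0).obj X) ≅ B :=
    (singleFunctor C 0).mapIso (asIso ((homologyFunctor C 0).map g)) ≪≫ eB.symm
  refine ⟨e₁.hom ≫ f, g ≫ e₃.inv, e₃.hom ≫ h ≫ e₁.inv⟦(1 : ℤ)⟧',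
    isomorphic_distinguished _ hT _ (Triangle.isoMk _ _ e₁ (Iso.refl _) e₃ ?_ ?_ ?_)⟩
  · exact comp_id (e₁.hom ≫ f)
  · change (g ≫ e₃.inv) ≫ e₃.hom = 𝟙 X ≫ g
    simp
  · change (e₃.hom ≫ h ≫ e₁.inv⟦(1 : ℤ)⟧') ≫ e₁.hom⟦(1 : ℤ)⟧' = e₃.hom ≫ h
    simp only [assoc, ← Functor.map_comp, Iso.inv_hom_id,
      CategoryTheory.Functor.map_id, comp_id]

end DerivedCategory

section

variable {C}

open DerivedCategory

lemma memHeart_of_iso (P : TorsionPair C) {X Y : DerivedCategory C} (e : X ≅ Y)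
    (hX : memHeart C P X) : memHeart C P Y :=
  ⟨fun i h₁ h₀ ↦ (hX.1 i h₁ h₀).of_iso ((homologyFunctor C i).mapIso e.symm),
    P.F_iso ((homologyFunctor C (-1)).mapIso e) hX.2.1,
    P.T_iso ((homologyFunctor C 0).mapIso e) hX.2.2⟩

lemma memHeart_single_zero (P : TorsionPair C) {Y : C} (hY : P.T Y) :
    memHeart C P ((singleFunctor C 0).obj Y) :=
  ⟨fun i _ h₀ ↦ isZero_homology_single 0 i h₀ Y,
    P.F_of_isZero (isZero_homology_single 0 (-1) (by simp) Y),
    P.T_iso (homologySingleIso 0 Y).symm hY⟩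

lemma memHeart_single_neg_one (P : TorsionPair C) {Y : C} (hY : P.F Y) :
    memHeart C P ((singleFunctor C (-1)).obj Y) :=
  ⟨fun i h₁ _ ↦ isZero_homology_single (-1) i h₁ Y,
    P.F_iso (homologySingleIso (-1) Y).symm hY,
    P.T_of_isZero (isZero_homology_single (-1) 0 (by simp) Y)⟩

end

/-- For any object `X` of the tilted heart `A(T, F)`, the one-degree complexes
`H^{-1}(X)[1]` and `H^0(X)` belong to `A(T, F)`, and there is a short exact sequence
`0 → H^{-1}(X)[1] → X → H^0(X) → 0` in `A(T, F)` (equivalently, a distinguished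
triangle in `D(C)` with all three vertices in the heart). -/
theorem stmt_1 (P : TorsionPair C) (X : DerivedCategory C) (hX : memHeart C P X) :
    memHeart C P (((DerivedCategory.singleFunctor C 0).obj
        ((DerivedCategory.homologyFunctor C (-1)).obj X))⟦(1 : ℤ)⟧) ∧
    memHeart C P ((DerivedCategory.singleFunctor C 0).obj
        ((DerivedCategory.homologyFunctor C 0).obj X)) ∧
    ∃ (f : ((DerivedCategory.singleFunctor C 0).obj
          ((DerivedCategory.homologyFunctor C (-1)).obj X))⟦(1 : ℤ)⟧ ⟶ X)
      (g : X ⟶ (DerivedCategory.singleFunctor C 0).obj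
          ((DerivedCategory.homologyFunctor C 0).obj X))
      (h : (DerivedCategory.singleFunctor C 0).obj
          ((DerivedCategory.homologyFunctor C 0).obj X) ⟶
        (((DerivedCategory.singleFunctor C 0).obj
          ((DerivedCategory.homologyFunctor C (-1)).obj X))⟦(1 : ℤ)⟧)⟦(1 : ℤ)⟧),
      Triangle.mk f g h ∈ distTriang (DerivedCategory C) := by
  have : X.IsGE (-1) := (X.isGE_iff (-1)).2 fun i hi ↦ hX.1 i (by lia) (by lia)
  have : X.IsLE 0 := (X.isLE_iff 0).2 fun i hi ↦ hX.1 i (by lia) (by lia)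
  exact ⟨memHeart_of_iso P (DerivedCategory.singleShiftOneIso _).symm
      (memHeart_single_neg_one P hX.2.1),
    memHeart_single_zero P hX.2.2, X.exists_distTriang_homology⟩
end

section
/- Let C be an abelian category, (T, F) a torsion pair in C, and A(T, F) the tilted heart in D(C). Let F' be the full subcategory of A(T, F) of objects X with H^0(X) = 0 (i.e. the objects F₀[1] with F₀ ∈ F) and T' the full subcategory of objects X with H^{-1}(X) = 0 (i.e. the objects of T). Then (F', T') is a torsion pair in the abelian category A(T, F): every morphism in A(T, F) from an object of F' to an object of T' is zero, and every object of A(T, F) fits into a short exact sequence in A(T, F) with subobject in F' and quotient in T'. -/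
open CategoryTheory Category Limits Pretriangulated

universe w v u

variable (C : Type u) [Category.{v} C] [Abelian C] [HasDerivedCategory.{w} C]

namespace TorsionPair

variable {C : Type u} [Category.{v} C] [Abelian C] (P : TorsionPair C)

lemma T_of_isZero_s2 {X : C} (hX : IsZero X) : P.T X := by
  obtain ⟨A, B, f, g, w, hS, hA, -⟩ := P.exists_ses X
  have : Mono f := hS.mono_f
  exact P.T_iso ((hX.of_mono f).iso hX) hA

lemma F_of_isZero_s2 {X : C} (hX : IsZero X) : P.F X := by
  obtain ⟨A, B, f, g, w, hS, -, hB⟩ := P.exists_ses X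
  have : Epi g := hS.epi_g
  exact P.F_iso ((hX.of_epi g).iso hX) hB

end TorsionPair

namespace DerivedCategory

variable {C : Type u} [Category.{v} C] [Abelian C] [HasDerivedCategory.{w} C]
  {T : Triangle (DerivedCategory C)} (hT : T ∈ distTriang (DerivedCategory C))

include hT

lemma isIso_homologyFunctor_map_mor₁ {n₀ n₁ : ℤ} (h : n₀ + 1 = n₁)
    (h₀ : IsZero ((homologyFunctor C n₀).obj T.obj₃))
    (h₁ : IsZero ((homologyFunctor C n₁).obj T.obj₃)) :
    IsIso ((homologyFunctor C n₁).map T.mor₁) := by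
  have : Mono ((homologyFunctor C n₁).map T.mor₁) :=
    (HomologySequence.mono_homologyMap_mor₁_iff T hT n₀ n₁ h).2 (h₀.eq_of_src _ _)
  have : Epi ((homologyFunctor C n₁).map T.mor₁) :=
    (HomologySequence.epi_homologyMap_mor₁_iff T hT n₁).2 (h₁.eq_of_tgt _ _)
  exact isIso_of_mono_of_epi _

lemma isIso_homologyFunctor_map_mor₂ {n₀ n₁ : ℤ} (h : n₀ + 1 = n₁)
    (h₀ : IsZero ((homologyFunctor C n₀).obj T.obj₁))
    (h₁ : IsZero ((homologyFunctor C n₁).obj T.obj₁)) :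
    IsIso ((homologyFunctor C n₀).map T.mor₂) := by
  have : Mono ((homologyFunctor C n₀).map T.mor₂) :=
    (HomologySequence.mono_homologyMap_mor₂_iff T hT n₀).2 (h₀.eq_of_src _ _)
  have : Epi ((homologyFunctor C n₀).map T.mor₂) :=
    (HomologySequence.epi_homologyMap_mor₂_iff T hT n₀ n₁ h).2 (h₁.eq_of_tgt _ _)
  exact isIso_of_mono_of_epi _

end DerivedCategory

/-- In the tilted heart `A(T, F)`, the subcategories `F' = {X ∈ A | H^0(X) = 0}`
(i.e. `F[1]`) and `T' = {X ∈ A | H^{-1}(X) = 0}` (i.e. `T`) form a torsion pair: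
every morphism (in `A`, i.e. in `D(C)`) from an object of `F'` to an object of `T'`
is zero, and every object of `A` sits in a short exact sequence in `A` (equivalently,
a distinguished triangle with vertices in `A`) with subobject in `F'` and quotient
in `T'`. -/
theorem stmt_2 (P : TorsionPair C) :
    (∀ (X Y : DerivedCategory C), memHeart C P X →
      IsZero ((DerivedCategory.homologyFunctor C 0).obj X) →
      memHeart C P Y →
      IsZero ((DerivedCategory.homologyFunctor C (-1)).obj Y) →
      ∀ f : X ⟶ Y, f = 0) ∧
    (∀ X : DerivedCategory C, memHeart C P X →
      ∃ (A B : DerivedCategory C),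
        memHeart C P A ∧ IsZero ((DerivedCategory.homologyFunctor C 0).obj A) ∧
        memHeart C P B ∧ IsZero ((DerivedCategory.homologyFunctor C (-1)).obj B) ∧
        ∃ (f : A ⟶ X) (g : X ⟶ B) (h : B ⟶ A⟦(1 : ℤ)⟧),
          Triangle.mk f g h ∈ distTriang (DerivedCategory C)) := by
  constructor
  · intro X Y hX hX₀ hY hY₁ f
    have : X.IsLE (-1) := (X.isLE_iff (-1)).2 fun i hi ↦ by
      obtain rfl | hi₀ := eq_or_ne i 0
      · exact hX₀
      · exact hX.1 i (by lia) hi₀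
    have : Y.IsGE 0 := (Y.isGE_iff 0).2 fun i hi ↦ by
      obtain rfl | hi₁ := eq_or_ne i (-1)
      · exact hY₁
      · exact hY.1 i hi₁ (by lia)
    exact DerivedCategory.TStructure.t.zero_of_isLE_of_isGE f (-1) 0 (by lia)
      inferInstance inferInstance
  · intro X hX
    obtain ⟨A, B, hA, hB, f, g, h, hT⟩ :=
      DerivedCategory.TStructure.t.exists_triangle X (-1) 0 (by lia)
    have zA := (A.isLE_iff (-1)).1 ⟨hA⟩
    have zB := (B.isGE_iff 0).1 ⟨hB⟩
    have eA (i : ℤ) (hi : i < 0) : (DerivedCategory.homologyFunctor C i).obj A ≅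
        (DerivedCategory.homologyFunctor C i).obj X :=
      have := DerivedCategory.isIso_homologyFunctor_map_mor₁ hT (sub_add_cancel i 1)
        (zB _ (by lia)) (zB _ hi)
      @asIso _ _ _ _ ((DerivedCategory.homologyFunctor C i).map f) this
    have eB (i : ℤ) (hi : -1 < i) : (DerivedCategory.homologyFunctor C i).obj X ≅
        (DerivedCategory.homologyFunctor C i).obj B :=
      have := DerivedCategory.isIso_homologyFunctor_map_mor₂ hT (rfl : i + 1 = i + 1)
        (zA _ hi) (zA _ (by lia))
      @asIso _ _ _ _ ((DerivedCategory.homologyFunctor C i).map g) this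
    refine ⟨A, B, ⟨fun i hi₁ hi₀ ↦ ?_, P.F_iso (eA (-1) (by lia)).symm hX.2.1,
      P.T_of_isZero_s2 (zA 0 (by lia))⟩, zA 0 (by lia), ⟨fun i hi₁ hi₀ ↦ ?_,
      P.F_of_isZero_s2 (zB (-1) (by lia)), P.T_iso (eB 0 (by lia)) hX.2.2⟩,
      zB (-1) (by lia), f, g, h, hT⟩
    · obtain hi | hi := lt_or_ge i 0
      · exact (hX.1 i hi₁ hi₀).of_iso (eA i hi)
      · exact zA i (by lia)
    · obtain hi | hi := lt_or_ge i 0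
      · exact zB i hi
      · exact (hX.1 i hi₁ hi₀).of_iso (eB i (by lia)).symm
end

section
/- Let C be an abelian category and (T, F) a torsion pair in C. An object of D(C) belongs to the tilted heart A(T, F) if and only if it is isomorphic in D(C) to (the image of) a two-term cochain complex E^{-1} →^{φ} E^0 concentrated in degrees -1 and 0 with ker(φ) ∈ F and coker(φ) ∈ T. -/
open CategoryTheory Category Limits Pretriangulated

universe w v u

variable (C : Type u) [Category.{v} C] [Abelian C] [HasDerivedCategory.{w} C]

open ZeroObject in
/-- The two-term cochain complex `E⁻¹ → E⁰` concentrated in degrees `-1` and `0`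
determined by a morphism `φ : E⁻¹ ⟶ E⁰`. -/
noncomputable def twoTermComplex {D : Type u} [Category.{v} D] [Abelian D]
    {A B : D} (φ : A ⟶ B) : CochainComplex D ℤ where
  X i := if i = -1 then A else if i = 0 then B else 0
  d i j :=
    if hij : i = -1 ∧ j = 0 then
      eqToHom (by simp [hij.1]) ≫ φ ≫ eqToHom (by simp [hij.2]) else 0
  shape i j h := by
    beta_reduce
    rw [dif_neg]
    rintro ⟨rfl, rfl⟩
    exact h (by simp)
  d_comp_d' i j k _ _ := by
    beta_reduce
    by_cases h1 : i = -1 ∧ j = 0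
    · have h2 : ¬ (j = -1 ∧ k = 0) := fun h2 => by
        have := h1.2; have := h2.1; omega
      rw [dif_neg h2, comp_zero]
    · rw [dif_neg h1, zero_comp]

section

variable {D : Type u} [Category.{v} D] [Abelian D]

section

variable {A B : D} (φ : A ⟶ B)

lemma twoTermComplex_X_neg_one : (twoTermComplex φ).X (-1) = A := by
  simp [twoTermComplex]

lemma twoTermComplex_X_zero : (twoTermComplex φ).X 0 = B := by
  simp [twoTermComplex]

lemma twoTermComplex_d :
    (twoTermComplex φ).d (-1) 0 =
      eqToHom (twoTermComplex_X_neg_one φ) ≫ φ ≫ eqToHom (twoTermComplex_X_zero φ).symm := by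
  dsimp only [twoTermComplex]
  rw [dif_pos ⟨rfl, rfl⟩]

lemma isZero_twoTermComplex_X (i : ℤ) (h₁ : i ≠ -1) (h₀ : i ≠ 0) :
    IsZero ((twoTermComplex φ).X i) := by
  dsimp only [twoTermComplex]
  rw [if_neg h₁, if_neg h₀]
  exact isZero_zero D

instance : (twoTermComplex φ).IsStrictlyGE (-1) := by
  rw [CochainComplex.isStrictlyGE_iff]
  intro i hi
  exact isZero_twoTermComplex_X φ i (by lia) (by lia)

instance : (twoTermComplex φ).IsStrictlyLE 0 := by
  rw [CochainComplex.isStrictlyLE_iff]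
  intro i hi
  exact isZero_twoTermComplex_X φ i (by lia) (by lia)

end

section

variable (K : CochainComplex D ℤ)

/-- The lowest cohomology of a complex concentrated in degrees `≥ n` is a kernel. -/
noncomputable def homologyIsoKernel (n m : ℤ) (hm : n + 1 = m) [K.IsStrictlyGE n] :
    K.homology n ≅ kernel (K.d n m) :=
  (K.isoHomologyπ (n - 1) n (by simp)
    ((K.isZero_of_isStrictlyGE n (n - 1)).eq_of_src _ _)).symm ≪≫
    (K.cyclesIsKernel n m (by simpa using hm)).conePointUniqueUpToIso
      (limit.isLimit _)

/-- The highest cohomology of a complex concentrated in degrees `≤ n` is a cokernel. -/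
noncomputable def homologyIsoCokernel (m n : ℤ) (hm : m + 1 = n) [K.IsStrictlyLE n] :
    K.homology n ≅ cokernel (K.d m n) :=
  K.isoHomologyι n (n + 1) (by simp)
    ((K.isZero_of_isStrictlyLE n (n + 1)).eq_of_tgt _ _) ≪≫
    (K.opcyclesIsCokernel m n (by simp [← hm])).coconePointUniqueUpToIso
      (colimit.isColimit _)

/-- A complex concentrated in degrees `-1` and `0` is a two-term complex. -/
noncomputable def isoTwoTermComplex [K.IsStrictlyGE (-1)] [K.IsStrictlyLE 0] :
    K ≅ twoTermComplex (K.d (-1) 0) :=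
  HomologicalComplex.Hom.isoOfComponents
    (fun i =>
      if h₁ : i = -1 then
        eqToIso (by subst h₁; exact (twoTermComplex_X_neg_one _).symm)
      else if h₀ : i = 0 then
        eqToIso (by subst h₀; exact (twoTermComplex_X_zero _).symm)
      else
        (show IsZero (K.X i) by
          by_cases hi : i < -1
          · exact K.isZero_of_isStrictlyGE (-1) i hi
          · exact K.isZero_of_isStrictlyLE 0 i (by lia)).iso
          (isZero_twoTermComplex_X _ i h₁ h₀))
    (by
      rintro i j rfl
      by_cases h₁ : i = -1
      · subst h₁
        change _ ≫ (twoTermComplex (K.d (-1) 0)).d (-1) 0 = K.d (-1) 0 ≫ _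
        simp [twoTermComplex_d]
      · by_cases hi : i < -1
        · exact (K.isZero_of_isStrictlyGE (-1) i hi).eq_of_src _ _
        · exact (isZero_twoTermComplex_X _ (i + 1) (by lia) (by lia)).eq_of_tgt _ _)

end

section

variable {A B : D} (φ : A ⟶ B)

/-- The cohomology in degree `-1` of a two-term complex is the kernel. -/
noncomputable def twoTermComplexHomologyNegOneIso :
    (twoTermComplex φ).homology (-1) ≅ kernel φ :=
  homologyIsoKernel _ (-1) 0 (by simp) ≪≫
    kernel.mapIso _ _ (eqToIso (twoTermComplex_X_neg_one φ))
      (eqToIso (twoTermComplex_X_zero φ)) (by simp [twoTermComplex_d])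

/-- The cohomology in degree `0` of a two-term complex is the cokernel. -/
noncomputable def twoTermComplexHomologyZeroIso :
    (twoTermComplex φ).homology 0 ≅ cokernel φ :=
  homologyIsoCokernel _ (-1) 0 (by simp) ≪≫
    cokernel.mapIso _ _ (eqToIso (twoTermComplex_X_neg_one φ))
      (eqToIso (twoTermComplex_X_zero φ)) (by simp [twoTermComplex_d])

end

namespace TorsionPair

variable (P : TorsionPair D)

lemma T_iff_of_iso {X Y : D} (e : X ≅ Y) : P.T X ↔ P.T Y :=
  ⟨P.T_iso e, P.T_iso e.symm⟩

lemma F_iff_of_iso {X Y : D} (e : X ≅ Y) : P.F X ↔ P.F Y :=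
  ⟨P.F_iso e, P.F_iso e.symm⟩

end TorsionPair

end

lemma memHeart_iff (P : TorsionPair C) (X : DerivedCategory C) :
    memHeart C P X ↔ (X.IsGE (-1) ∧ X.IsLE 0) ∧
      P.F ((DerivedCategory.homologyFunctor C (-1)).obj X) ∧
      P.T ((DerivedCategory.homologyFunctor C 0).obj X) := by
  rw [memHeart, X.isGE_iff, X.isLE_iff]
  refine and_congr_left fun _ => ⟨fun h => ⟨fun i hi => h i (by lia) (by lia),
    fun i hi => h i (by lia) (by lia)⟩, fun h i h₁ h₀ => ?_⟩
  by_cases hi : i < -1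
  · exact h.1 i hi
  · exact h.2 i (by lia)

lemma memHeart_iff_of_iso (P : TorsionPair C) {X Y : DerivedCategory C} (e : X ≅ Y) :
    memHeart C P X ↔ memHeart C P Y := by
  have e' (n : ℤ) := (DerivedCategory.homologyFunctor C n).mapIso e
  rw [memHeart, memHeart, P.F_iff_of_iso (e' (-1)), P.T_iff_of_iso (e' 0)]
  simp only [(e' _).isZero_iff]

lemma memHeart_Q_obj_twoTermComplex_iff (P : TorsionPair C) {E₁ E₀ : C} (φ : E₁ ⟶ E₀) :
    memHeart C P (DerivedCategory.Q.obj (twoTermComplex φ)) ↔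
      P.F (kernel φ) ∧ P.T (cokernel φ) := by
  have e (n : ℤ) := (DerivedCategory.homologyFunctorFactors C n).app (twoTermComplex φ)
  rw [memHeart_iff, ← P.F_iff_of_iso (e (-1) ≪≫ twoTermComplexHomologyNegOneIso φ),
    ← P.T_iff_of_iso (e 0 ≪≫ twoTermComplexHomologyZeroIso φ)]
  exact and_iff_right ⟨inferInstance, inferInstance⟩

/-- An object of `D(C)` belongs to the tilted heart `A(T, F)` if and only if it is
isomorphic in `D(C)` to the image of a two-term complex `E⁻¹ →^φ E⁰` concentrated in
degrees `-1` and `0` with `ker φ ∈ F` and `coker φ ∈ T`. -/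
theorem stmt_3 (P : TorsionPair C) (X : DerivedCategory C) :
    memHeart C P X ↔
      ∃ (E₁ E₀ : C) (φ : E₁ ⟶ E₀), P.F (kernel φ) ∧ P.T (cokernel φ) ∧
        Nonempty (X ≅ DerivedCategory.Q.obj (twoTermComplex φ)) := by
  refine ⟨fun h => ?_, fun ⟨E₁, E₀, φ, hF, hT, ⟨e⟩⟩ => ?_⟩
  · obtain ⟨⟨_, _⟩, -⟩ := (memHeart_iff C P X).1 h
    obtain ⟨K, _, _, ⟨e⟩⟩ := X.exists_iso_Q_obj_of_isGE_of_isLE (-1) 0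
    have e' := e ≪≫ DerivedCategory.Q.mapIso (isoTwoTermComplex K)
    obtain ⟨hF, hT⟩ := (memHeart_Q_obj_twoTermComplex_iff C P _).1
      ((memHeart_iff_of_iso C P e').1 h)
    exact ⟨_, _, _, hF, hT, ⟨e'⟩⟩
  · exact (memHeart_iff_of_iso C P e).2
      ((memHeart_Q_obj_twoTermComplex_iff C P φ).2 ⟨hF, hT⟩)
end

section
/- Let C be an abelian category and (T, F) a cotilting torsion pair in C. Then every object E of C admits a resolution of length two by objects of F, i.e. there is a short exact sequence 0 → F₁ → F₀ → E → 0 in C with F₀ and F₁ in F. -/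
open CategoryTheory Category Limits Pretriangulated

universe w v u

/-- The torsion-free class of a torsion pair is closed under subobjects. -/
theorem TorsionPair.F_of_mono {C : Type u} [Category.{v} C] [Abelian C] (P : TorsionPair C)
    {X Y : C} (i : X ⟶ Y) [Mono i] (hY : P.F Y) : P.F X := by
  obtain ⟨A, B, f, g, w, hS, hA, hB⟩ := P.exists_ses X
  have hf : f = 0 := by
    rw [← cancel_mono i, zero_comp]
    exact P.hom_zero hA hY _
  have : Mono g := hS.exact.mono_g hf
  have : Epi g := hS.epi_g
  have : IsIso g := isIso_of_mono_of_epi g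
  exact P.F_iso (asIso g).symm hB

/-- If `(T, F)` is a cotilting torsion pair (every object of `C` is a quotient of an
object of `F`), then every object `E` of `C` admits a length-two resolution
`0 → F₁ → F₀ → E → 0` with `F₀, F₁ ∈ F`. -/
theorem stmt_5 (C : Type u) [Category.{v} C] [Abelian C] (P : TorsionPair C)
    (hcotilting : ∀ E : C, ∃ (F₀ : C), P.F F₀ ∧ ∃ π : F₀ ⟶ E, Epi π)
    (E : C) :
    ∃ (F₁ F₀ : C) (f : F₁ ⟶ F₀) (g : F₀ ⟶ E) (w : f ≫ g = 0),
      (CategoryTheory.ShortComplex.mk f g w).ShortExact ∧ P.F F₁ ∧ P.F F₀ := by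
  obtain ⟨F₀, hF₀, π, hπ⟩ := hcotilting E
  refine ⟨kernel π, F₀, kernel.ι π, π, kernel.condition π, ?_, P.F_of_mono (kernel.ι π) hF₀, hF₀⟩
  exact { exact := ShortComplex.exact_kernel π }
end

section
/- Let r be a positive integer and let d, β be real numbers with d > 0 and d/r < β. Then there exist positive integers a and b such that (d + a·d)/(r + b) ≤ β < (a·d)/b. -/
/-- Integer multiples of an irrational number come arbitrarily close to integers from below. -/
theorem Irrational.exists_int_mul_lt_le_add {x ε : ℝ} (hx : Irrational x) (hε : 0 < ε) :
    ∃ a b : ℤ, 0 < b ∧ b * x < a ∧ a ≤ b * x + ε := by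
  obtain ⟨n, hn⟩ := exists_nat_one_div_lt (lt_min hε one_pos)
  obtain ⟨p, m, hm, -, hpm⟩ := Real.exists_int_int_abs_mul_sub_le x (Nat.succ_pos n)
  have hle : |(m : ℝ) * x - p| < min ε 1 := by
    refine hpm.trans_lt (lt_of_le_of_lt ?_ hn)
    push_cast
    gcongr
    linarith
  obtain ⟨hlt_ε, hlt_one⟩ := lt_min_iff.mp hle
  rcases lt_trichotomy ((m : ℝ) * x) p with hlt | heq | hgt
  · exact ⟨p, m, hm, hlt, by linarith [(abs_lt.mp hlt_ε).1]⟩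
  · exact absurd heq ((hx.intCast_mul hm.ne').ne_int p)
  · set δ := (m : ℝ) * x - p with hδ
    have hδ_pos : 0 < δ := sub_pos.mpr hgt
    rw [abs_of_pos hδ_pos] at hlt_ε hlt_one
    have hk_lt : ((⌈1 / δ⌉ - 1 : ℤ) : ℝ) * δ < 1 := by
      rw [← lt_div_iff₀ hδ_pos]
      push_cast
      linarith [Int.ceil_lt_add_one (1 / δ)]
    have hk_ge : 1 ≤ ((⌈1 / δ⌉ - 1 : ℤ) : ℝ) * δ + δ := by
      have := (div_le_iff₀ hδ_pos).mp (Int.le_ceil (1 / δ))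
      push_cast
      linarith
    have hk_pos : 0 < ⌈1 / δ⌉ - 1 := by
      have : 1 < ⌈1 / δ⌉ := Int.lt_ceil.mpr (by
        rw [Int.cast_one]
        exact one_lt_one_div hδ_pos hlt_one)
      lia
    generalize ⌈1 / δ⌉ - 1 = k at hk_lt hk_ge hk_pos
    have hkδ : (k : ℝ) * δ = k * m * x - k * p := by rw [hδ]; ring
    refine ⟨k * p + 1, k * m, mul_pos hk_pos hm, ?_, ?_⟩ <;> push_cast <;> linarith

/-- For every rational `q` some positive multiple of `q` lies exactly `1 / q.den` below an
integer. -/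
theorem Rat.exists_int_den_mul_eq (q : ℚ) :
    ∃ a b : ℤ, 0 < b ∧ q.den * a = q.num * b + 1 := by
  obtain ⟨u, v, huv⟩ := Rat.isCoprime_num_den q
  have hden : (0 : ℤ) < q.den := mod_cast q.den_pos
  refine ⟨v + q.num * (|u| + 1), -u + q.den * (|u| + 1), ?_, by linear_combination huv⟩
  nlinarith [le_abs_self u, abs_nonneg u]

theorem exists_int_mul_lt_le_add_mul_sub_one {x : ℝ} {r : ℤ} (h : 1 < x * r) :
    ∃ a b : ℤ, 0 < b ∧ b * x < a ∧ a ≤ b * x + (x * r - 1) := by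
  by_cases hx : Irrational x
  · exact hx.exists_int_mul_lt_le_add (sub_pos.mpr h)
  obtain ⟨q, rfl⟩ := not_not.mp hx
  obtain ⟨a, b, hb, hab⟩ := q.exists_int_den_mul_eq
  have hden : (0 : ℝ) < q.den := mod_cast q.den_pos
  have hq : (q.den : ℝ) * q = q.num := mod_cast Rat.den_mul_eq_num q
  have habR : (q.den : ℝ) * a = q.num * b + 1 := mod_cast hab
  have hnum : (q.den : ℝ) + 1 ≤ q.num * r := by
    have : (q.den : ℝ) < q.num * r := by
      rw [← hq]
      nlinarith
    have : (q.den : ℤ) < q.num * r := mod_cast this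
    exact_mod_cast Int.add_one_le_iff.mpr this
  refine ⟨a, b, hb, lt_of_mul_lt_mul_left ?_ hden.le, le_of_mul_le_mul_left ?_ hden⟩
  · linear_combination (b : ℝ) * hq - habR
  · linear_combination habR + hnum - (b + r : ℝ) * hq

/-- Numerical content of the line-bundle existence lemma: if `r` is a positive
integer and `d, β` are reals with `d > 0` and `d/r < β`, then there are positive
integers `a, b` with `(d + a·d)/(r + b) ≤ β < (a·d)/b`. -/
theorem stmt_14 (r : ℕ) (hr : 0 < r) (d β : ℝ) (hd : 0 < d) (h : d / r < β) :
    ∃ a b : ℕ, 0 < a ∧ 0 < b ∧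
      (d + a * d) / (r + b) ≤ β ∧ β < (a * d) / b := by
  have hr' : (0 : ℝ) < r := mod_cast hr
  have hβ : 0 < β := (div_pos hd hr').trans h
  have hx : 1 < β / d * (r : ℤ) := by
    rw [div_mul_eq_mul_div, one_lt_div hd]
    exact_mod_cast (div_lt_iff₀ hr').mp h
  obtain ⟨a, b, hb, hlt, hle⟩ := exists_int_mul_lt_le_add_mul_sub_one hx
  have hbR : (0 : ℝ) < b := mod_cast hb
  have ha : 0 < a := by
    have : (0 : ℝ) < a := (mul_pos hbR (div_pos hβ hd)).trans hlt
    exact_mod_cast this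
  lift a to ℕ using ha.le
  lift b to ℕ using hb.le
  push_cast at hlt hle hbR
  have hβd : β / d * d = β := div_mul_cancel₀ β hd.ne'
  refine ⟨a, b, mod_cast ha, mod_cast hb, ?_, ?_⟩
  · rw [div_le_iff₀ (by positivity)]
    linear_combination d * hle + (b + r : ℝ) * hβd
  · rw [lt_div_iff₀ hbR]
    linear_combination d * hlt - (b : ℝ) * hβd
end

section
/- Let r, r', r₁' be positive integers and r₁ a nonnegative integer with r₁ ≤ r and r₁' < r'. Let ℓ, ℓ', ℓ₁, ℓ₁', e be real numbers satisfying: (i) ℓ₁·r ≤ ℓ·r₁; (ii) ℓ₁'/r₁' < ℓ'/r' − e/r₁'; (iii) ℓ/r ≤ ℓ'/r'; and (iv) e ≥ ((r'·r − r)/(r + r'))·(ℓ'/r' − ℓ/r). Then (ℓ₁ + ℓ₁')/(r₁ + r₁') < (ℓ + ℓ')/(r + r'). -/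
/-- Numerical heart of the slope estimate in the stable-extension proposition. -/
theorem stmt_16 (r r' r₁' r₁ : ℕ) (hr : 0 < r) (hr' : 0 < r') (hr₁' : 0 < r₁')
    (hr₁ : r₁ ≤ r) (hr₁'r' : r₁' < r')
    (ℓ ℓ' ℓ₁ ℓ₁' e : ℝ)
    (hi : ℓ₁ * r ≤ ℓ * r₁)
    (hii : ℓ₁' / r₁' < ℓ' / r' - e / r₁')
    (hiii : ℓ / r ≤ ℓ' / r')
    (hiv : e ≥ (((r' : ℝ) * r - r) / (r + r')) * (ℓ' / r' - ℓ / r)) :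
    (ℓ₁ + ℓ₁') / (r₁ + r₁') < (ℓ + ℓ') / (r + r') := by
  have hR : (0 : ℝ) < r := by exact_mod_cast hr
  have hR' : (0 : ℝ) < r' := by exact_mod_cast hr'
  have hR₁' : (0 : ℝ) < r₁' := by exact_mod_cast hr₁'
  have hR₁ : (0 : ℝ) ≤ r₁ := by positivity
  have hlt : (r₁' : ℝ) + 1 ≤ r' := by exact_mod_cast hr₁'r'
  obtain ⟨a, rfl⟩ : ∃ a, ℓ = a * r := ⟨ℓ / r, by field_simp⟩
  obtain ⟨b, rfl⟩ : ∃ b, ℓ' = b * r' := ⟨ℓ' / r', by field_simp⟩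
  rw [mul_div_cancel_right₀ _ hR.ne', mul_div_cancel_right₀ _ hR'.ne'] at hiii hiv
  rw [mul_div_cancel_right₀ _ hR'.ne', lt_sub_iff_add_lt, ← add_div, div_lt_iff₀ hR₁'] at hii
  have hsub : ℓ₁ ≤ a * r₁ := by
    refine le_of_mul_le_mul_right ?_ hR
    linarith
  have he : ((r' : ℝ) * r - r) * (b - a) ≤ e * (r + r') := by
    rwa [ge_iff_le, div_mul_eq_mul_div, div_le_iff₀ (by positivity)] at hiv
  have hrank : (r₁' : ℝ) * r - r₁ * r' ≤ r' * r - r := by nlinarith [mul_nonneg hR₁ hR'.le]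
  have hgap := mul_le_mul_of_nonneg_right hrank (sub_nonneg.2 hiii)
  have hsum : ℓ₁ + ℓ₁' < a * r₁ + b * r₁' - e := by linarith
  have hmul := mul_lt_mul_of_pos_right hsum (add_pos hR hR')
  rw [div_lt_div_iff₀ (by positivity) (by positivity)]
  linarith
end
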